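/- arXiv:2312.14749 — 5 statements merged into one kernel-verified Lean document; each statement's English description precedes it below -/
import Mathlib

section
/- Let I ⊆ {0,...,N-1} be a nonempty decreasing set and let T be any upper triangular matrix over F₂ with t_{i,i} = 1 for all i ∈ I. Then the minimum distance of the pre-transformed polar code P(I,T) equals the minimum distance of the plain polar code P(I); both are equal to w_min(I) = min_{i∈I} 2^{w(i)}. -/
open Matrix

/-- The polar transform `G_N`, the `n`-fold Kronecker power of `[[1,0],[1,1]]` over `F₂`,
indexed MSB-first. -/
def polarG : (n : ℕ) → Matrix (Fin (2 ^ n)) (Fin (2 ^ n)) (ZMod 2)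
  | 0 => 1
  | n + 1 =>
      Matrix.reindex (finProdFinEquiv.trans (finCongr (by ring)))
        (finProdFinEquiv.trans (finCongr (by ring)))
        (Matrix.kroneckerMap (· * ·)
          (!![1, 0; 1, 1] : Matrix (Fin 2) (Fin 2) (ZMod 2)) (polarG n))

/-- Binary Hamming weight of `i`: the number of ones among bits `0,...,n-1`. -/
def bitWeight (n i : ℕ) : ℕ := ((Finset.range n).filter (fun l => i.testBit l)).card

/-- Left-swap rule of the polar partial order. -/
def leftSwap (i j : ℕ) : Prop :=
  ∃ l, i.testBit l = true ∧ i.testBit (l + 1) = false ∧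
    j.testBit l = false ∧ j.testBit (l + 1) = true ∧
    ∀ l', l' ≠ l → l' ≠ l + 1 → i.testBit l' = j.testBit l'

/-- Binary-domination rule of the polar partial order: `i_(l) ≤ j_(l)` for all `l`. -/
def binDom (i j : ℕ) : Prop := ∀ l, i.testBit l = true → j.testBit l = true

/-- The polar partial order: reflexive-transitive closure of the two rules. -/
def polarLE : ℕ → ℕ → Prop :=
  Relation.ReflTransGen (fun i j => leftSwap i j ∨ binDom i j)

/-- The plain polar code with information set `I`. -/
def polarCode (n : ℕ) (I : Finset (Fin (2 ^ n))) : Set (Fin (2 ^ n) → ZMod 2) :=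
  { c | ∃ u : Fin (2 ^ n) → ZMod 2, (∀ j, j ∉ I → u j = 0) ∧ c = u ᵥ* polarG n }

/-- The pre-transformed polar code with rate profile `I` and pre-transform `T`. -/
def ptpc (n : ℕ) (I : Finset (Fin (2 ^ n)))
    (T : Matrix (Fin (2 ^ n)) (Fin (2 ^ n)) (ZMod 2)) : Set (Fin (2 ^ n) → ZMod 2) :=
  { c | ∃ v : Fin (2 ^ n) → ZMod 2, (∀ j, j ∉ I → v j = 0) ∧ c = (v ᵥ* T) ᵥ* polarG n }

/-- `T` is upper triangular: `T i j = 0` whenever `i > j`. -/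
def UpperTri {N : ℕ} (T : Matrix (Fin N) (Fin N) (ZMod 2)) : Prop :=
  ∀ i j : Fin N, j < i → T i j = 0

/-- Minimum distance: the minimum Hamming weight of nonzero codewords. -/
noncomputable def dmin {N : ℕ} (C : Set (Fin N → ZMod 2)) : ℕ :=
  sInf { w | ∃ c ∈ C, c ≠ 0 ∧ hammingNorm c = w }


/-- Splitting of an index of length `n+1` in its top bit and the rest. -/
def splitE (n : ℕ) : Fin 2 × Fin (2 ^ n) ≃ Fin (2 ^ (n + 1)) :=
  finProdFinEquiv.trans (finCongr (by ring))

lemma splitE_val (n : ℕ) (a : Fin 2) (x : Fin (2 ^ n)) :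
    (splitE n (a, x)).val = x.val + 2 ^ n * a.val := by
  simp [splitE]

lemma polarG_succ_apply (n : ℕ) (a b : Fin 2) (x y : Fin (2 ^ n)) :
    polarG (n + 1) (splitE n (a, x)) (splitE n (b, y)) =
      (!![1, 0; 1, 1] : Matrix (Fin 2) (Fin 2) (ZMod 2)) a b * polarG n x y := by
  have h : polarG (n + 1) = Matrix.reindex (splitE n) (splitE n)
        (Matrix.kroneckerMap (· * ·)
          (!![1, 0; 1, 1] : Matrix (Fin 2) (Fin 2) (ZMod 2)) (polarG n)) := rfl
  rw [h]
  simp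

lemma vecMul_split (n : ℕ) (u : Fin (2 ^ (n + 1)) → ZMod 2) (b : Fin 2) (y : Fin (2 ^ n)) :
    (u ᵥ* polarG (n + 1)) (splitE n (b, y)) =
      ((fun x => u (splitE n (0, x)) *
          (!![1, 0; 1, 1] : Matrix (Fin 2) (Fin 2) (ZMod 2)) 0 b +
        u (splitE n (1, x)) *
          (!![1, 0; 1, 1] : Matrix (Fin 2) (Fin 2) (ZMod 2)) 1 b) ᵥ* polarG n) y := by
  simp only [Matrix.vecMul, dotProduct]
  rw [← (splitE n).sum_comp, Fintype.sum_prod_type, Fin.sum_univ_two, ← Finset.sum_add_distrib]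
  refine Finset.sum_congr rfl fun x _ => ?_
  rw [polarG_succ_apply, polarG_succ_apply]
  ring

lemma hammingNorm_split (n : ℕ) (c : Fin (2 ^ (n + 1)) → ZMod 2) :
    hammingNorm c = hammingNorm (fun x => c (splitE n (0, x))) +
      hammingNorm (fun x => c (splitE n (1, x))) := by
  simp only [hammingNorm, Finset.card_filter]
  rw [← (splitE n).sum_comp, Fintype.sum_prod_type, Fin.sum_univ_two]

lemma norm_succ (n : ℕ) (u : Fin (2 ^ (n + 1)) → ZMod 2) :
    hammingNorm (u ᵥ* polarG (n + 1)) =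
      hammingNorm ((fun x => u (splitE n (0, x)) + u (splitE n (1, x))) ᵥ* polarG n) +
      hammingNorm ((fun x => u (splitE n (1, x))) ᵥ* polarG n) := by
  rw [hammingNorm_split]
  simp only [vecMul_split]
  simp

lemma bitWeight_lo (n : ℕ) (x : Fin (2 ^ n)) :
    bitWeight (n + 1) (splitE n (0, x)).val = bitWeight n x.val := by
  rw [splitE_val]
  simp [bitWeight, Finset.range_add_one, Finset.filter_insert, Nat.testBit_lt_two_pow x.isLt]

lemma bitWeight_hi (n : ℕ) (x : Fin (2 ^ n)) :
    bitWeight (n + 1) (splitE n (1, x)).val = bitWeight n x.val + 1 := by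
  rw [splitE_val]
  have h : ∀ l ∈ Finset.range n, ((x.val + 2 ^ n).testBit l = true ↔ x.val.testBit l = true) := by
    intro l hl
    rw [add_comm, Nat.testBit_two_pow_add_gt (Finset.mem_range.1 hl)]
  have h2 : (x.val + 2 ^ n).testBit n = true := by
    rw [add_comm, Nat.testBit_two_pow_add_eq, Nat.testBit_lt_two_pow x.isLt]; rfl
  simp [bitWeight, Finset.range_add_one, Finset.filter_insert, h2, Finset.filter_congr h]

lemma lower (n : ℕ) : ∀ (u : Fin (2 ^ n) → ZMod 2) (i : Fin (2 ^ n)),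
    (∀ j < i, u j = 0) → u i ≠ 0 → 2 ^ bitWeight n i.val ≤ hammingNorm (u ᵥ* polarG n) := by
  induction n with
  | zero =>
    intro u i _ hi
    have h : u ≠ 0 := fun h => hi (by simp [h])
    have := hammingNorm_pos_iff.2 h
    have h2 : hammingNorm (u ᵥ* polarG 0) = hammingNorm u := by simp [polarG]
    rw [h2]
    simp only [bitWeight, Finset.range_zero, Finset.filter_empty, Finset.card_empty, pow_zero]
    exact this
  | succ n ih =>
    intro u i hlt hi
    obtain ⟨⟨a, x⟩, rfl⟩ := (splitE n).surjective i
    rw [norm_succ]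
    fin_cases a
    · simp only [Fin.zero_eta] at *
      rw [bitWeight_lo]
      have h1 := ih (fun x => u (splitE n (0, x))) x (fun j hj => hlt _ (by
        rw [Fin.lt_def, splitE_val, splitE_val]; simpa using hj)) hi
      refine h1.trans ?_
      set A := (fun x => u (splitE n (0, x)))
      set B := (fun x => u (splitE n (1, x)))
      have hA : A = (A + B) - B := by simp
      have : hammingNorm (A ᵥ* polarG n) =
          hammingDist ((A + B) ᵥ* polarG n) (B ᵥ* polarG n) := by
        rw [hammingDist_comm, hammingDist_eq_hammingNorm, Matrix.add_vecMul]
        congr 1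
        ext k
        simp only [Pi.add_apply, Pi.neg_apply, Pi.sub_apply, CharTwo.neg_eq, CharTwo.sub_eq_add]
        generalize (A ᵥ* polarG n) k = a
        generalize (B ᵥ* polarG n) k = b
        revert a b; decide
      rw [this]
      refine (hammingDist_triangle _ 0 _).trans ?_
      rw [hammingDist_zero_right, hammingDist_zero_left]
      rfl
    · simp only [Fin.mk_one] at *
      rw [bitWeight_hi]
      have h0 : ∀ y, u (splitE n (0, y)) = 0 := fun y => hlt _ (by
        rw [Fin.lt_def, splitE_val, splitE_val]; have := y.isLt; simp; omega)
      have h1 := ih (fun x => u (splitE n (1, x))) x (fun j hj => hlt _ (by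
        rw [Fin.lt_def, splitE_val, splitE_val]; simpa using hj)) hi
      simp only [h0, zero_add]
      rw [pow_succ]; omega

lemma upper (n : ℕ) : ∀ i : Fin (2 ^ n),
    hammingNorm ((Pi.single i 1 : Fin (2 ^ n) → ZMod 2) ᵥ* polarG n) ≤
      2 ^ bitWeight n i.val := by
  induction n with
  | zero =>
    intro i
    simpa [bitWeight] using hammingNorm_le_card_fintype
      (x := (Pi.single i 1 : Fin (2 ^ 0) → ZMod 2) ᵥ* polarG 0)
  | succ n ih =>
    intro i
    obtain ⟨⟨a, x⟩, rfl⟩ := (splitE n).surjective i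
    have hs : ∀ b y, (Pi.single (splitE n (a, x)) 1 : Fin (2 ^ (n + 1)) → ZMod 2)
        (splitE n (b, y)) = if b = a then (Pi.single x 1 : Fin (2 ^ n) → ZMod 2) y else 0 := by
      intro b y
      simp only [Pi.single_apply, (splitE n).injective.eq_iff, Prod.mk.injEq]
      split_ifs <;> simp_all
    rw [norm_succ]
    simp only [hs]
    have hx := ih x
    fin_cases a
    · simp only [Fin.zero_eta] at *
      rw [bitWeight_lo]
      simp only [if_true, one_ne_zero, if_false, add_zero]
      have : hammingNorm ((fun _ : Fin (2 ^ n) => (0 : ZMod 2)) ᵥ* polarG n) = 0 := by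
        rw [hammingNorm_eq_zero]; exact Matrix.zero_vecMul _
      rw [this]; exact hx
    · simp only [Fin.mk_one] at *
      rw [bitWeight_hi]
      simp only [if_true, zero_ne_one, if_false, zero_add]
      rw [pow_succ]
      change hammingNorm ((Pi.single x 1 : Fin (2 ^ n) → ZMod 2) ᵥ* polarG n) +
        hammingNorm ((Pi.single x 1 : Fin (2 ^ n) → ZMod 2) ᵥ* polarG n) ≤ _
      omega

/-- Vectors supported on `I`. -/
def suppSub {N : ℕ} (I : Finset (Fin N)) : Submodule (ZMod 2) (Fin N → ZMod 2) where
  carrier := {v | ∀ j, j ∉ I → v j = 0}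
  zero_mem' := by intro j _; rfl
  add_mem' := by intro a b ha hb j hj; simp [ha j hj, hb j hj]
  smul_mem' := by intro c a ha j hj; simp [ha j hj]

lemma single_mem {N : ℕ} (I : Finset (Fin N)) (T : Matrix (Fin N) (Fin N) (ZMod 2))
    (hT : UpperTri T) (hTd : ∀ i ∈ I, T i i = 1) :
    ∀ (m : ℕ) (i : Fin N), N - i.val ≤ m → (∀ j, i ≤ j → j ∈ I) →
      (Pi.single i 1 : Fin N → ZMod 2) ∈ (suppSub I).map (Matrix.vecMulLinear T) := by
  intro m
  induction m with
  | zero => intro i hi; have := i.isLt; omega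
  | succ m ih =>
    intro i hi hI
    have hrow : T i ∈ (suppSub I).map (Matrix.vecMulLinear T) := by
      refine ⟨Pi.single i 1, ?_, ?_⟩
      · intro j hj
        have : j ≠ i := by rintro rfl; exact hj (hI _ le_rfl)
        simp [this]
      · simp [Matrix.row]
    have hsum : (∑ j ∈ Finset.Ioi i, T i j • (Pi.single j 1 : Fin N → ZMod 2)) ∈
        (suppSub I).map (Matrix.vecMulLinear T) := by
      refine Submodule.sum_mem _ fun j hj => Submodule.smul_mem _ _ ?_
      have hj' : i < j := Finset.mem_Ioi.1 hj
      refine ih j ?_ fun k hk => hI k (hj'.le.trans hk)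
      have : i.val < j.val := hj'
      have := j.isLt
      omega
    have : (Pi.single i 1 : Fin N → ZMod 2) =
        T i - ∑ j ∈ Finset.Ioi i, T i j • (Pi.single j 1 : Fin N → ZMod 2) := by
      ext k
      simp only [Pi.sub_apply, Finset.sum_apply, Pi.smul_apply, Pi.single_apply, smul_eq_mul,
        mul_ite, mul_one, mul_zero, Finset.sum_ite_eq, Finset.mem_Ioi]
      rcases lt_trichotomy k i with h | h | h
      · simp [h.ne, h.not_gt, hT i k h]
      · subst h; simp [hTd k (hI k le_rfl)]
      · simp [h.ne', h]
    rw [this]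
    exact Submodule.sub_mem _ hrow hsum

lemma swap_exists (n i l : ℕ) (hi : i < 2 ^ n) (hl : l + 1 < n) (h1 : i.testBit l = true)
    (h0 : i.testBit (l + 1) = false) :
    ∃ j, j < 2 ^ n ∧ i < j ∧ leftSwap i j ∧ bitWeight n j = bitWeight n i := by
  have hb : ∀ m, (i ^^^ 2 ^ l ^^^ 2 ^ (l + 1)).testBit m = i.testBit (Equiv.swap l (l + 1) m) := by
    intro m
    rw [Nat.testBit_xor, Nat.testBit_xor, Nat.testBit_two_pow, Nat.testBit_two_pow]
    rcases eq_or_ne m l with rfl | hm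
    · simp [h1, h0]
    · rcases eq_or_ne m (l + 1) with rfl | hm'
      · simp [h1, h0]
      · rw [Equiv.swap_apply_of_ne_of_ne hm hm']
        simp [hm.symm, hm'.symm]
  have hother : ∀ l', l' ≠ l → l' ≠ l + 1 →
      i.testBit l' = (i ^^^ 2 ^ l ^^^ 2 ^ (l + 1)).testBit l' := by
    intro m hm hm'
    rw [hb, Equiv.swap_apply_of_ne_of_ne hm hm']
  refine ⟨i ^^^ 2 ^ l ^^^ 2 ^ (l + 1), ?_, ?_, ⟨l, h1, h0, ?_, ?_, hother⟩, ?_⟩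
  · refine Nat.xor_lt_two_pow (Nat.xor_lt_two_pow hi ?_) ?_ <;>
      exact Nat.pow_lt_pow_right (by norm_num) (by omega)
  · refine Nat.lt_of_testBit (l + 1) h0 ?_ fun j hj => hother j (by omega) (by omega)
    rw [hb]; simpa using h1
  · rw [hb]; simpa using h0
  · rw [hb]; simpa using h1
  · unfold bitWeight
    have hr : ∀ m, m < n → Equiv.swap l (l + 1) m < n := by
      intro m hm
      rw [Equiv.swap_apply_def]; split_ifs <;> omega
    refine Finset.card_bij' (fun m _ => Equiv.swap l (l + 1) m)
      (fun m _ => Equiv.swap l (l + 1) m) ?_ ?_ ?_ ?_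
    · intro m hm
      simp only [Finset.mem_filter, Finset.mem_range, hb] at hm ⊢
      exact ⟨hr m hm.1, hm.2⟩
    · intro m hm
      simp only [Finset.mem_filter, Finset.mem_range, hb] at hm ⊢
      exact ⟨hr m hm.1, by simpa using hm.2⟩
    · intro m _; simp
    · intro m _; simp

lemma dom_of_le (n i j : ℕ) (hi : i < 2 ^ n) (hj : j < 2 ^ n) (hij : i ≤ j)
    (h : ∀ l, l + 1 < n → i.testBit l = true → i.testBit (l + 1) = true) : binDom i j := by
  intro l hl
  by_contra hjl
  have hall : ∀ m, l + m < n → i.testBit (l + m) = true := by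
    intro m
    induction m with
    | zero => intro _; exact hl
    | succ m ih => intro hm; exact h (l + m) (by omega) (ih (by omega))
  have hji : j >>> l ≤ i >>> l := by
    refine Nat.le_of_testBit fun m hm => ?_
    rw [Nat.testBit_shiftRight] at hm ⊢
    refine hall m ?_
    by_contra hc
    rw [Nat.testBit_lt_two_pow (hj.trans_le (Nat.pow_le_pow_right (by norm_num) (by omega)))] at hm
    exact absurd hm (by simp)
  have hij' : i >>> l ≤ j >>> l := by
    rw [Nat.shiftRight_eq_div_pow, Nat.shiftRight_eq_div_pow]
    exact Nat.div_le_div_right hij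
  have he := le_antisymm hij' hji
  have := congrArg (fun x => x.testBit 0) he
  simp only [Nat.testBit_shiftRight, add_zero] at this
  exact hjl (this ▸ hl)

lemma ptpc_main (n : ℕ) (I : Finset (Fin (2 ^ n))) (hI : I.Nonempty)
    (hdec : ∀ i ∈ I, ∀ j : Fin (2 ^ n), polarLE i.val j.val → j ∈ I)
    (T : Matrix (Fin (2 ^ n)) (Fin (2 ^ n)) (ZMod 2))
    (hT : UpperTri T) (hTd : ∀ i ∈ I, T i i = 1) :
    dmin (ptpc n I T) = I.inf' hI (fun i => 2 ^ bitWeight n i.val) := by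
  set W := I.inf' hI (fun i => 2 ^ bitWeight n i.val) with hW
  -- lower bound
  have hlow : ∀ c ∈ ptpc n I T, c ≠ 0 → W ≤ hammingNorm c := by
    rintro c ⟨v, hv, rfl⟩ hc
    have hv0 : (Finset.univ.filter fun i => v i ≠ 0).Nonempty := by
      by_contra hne
      rw [Finset.not_nonempty_iff_eq_empty, Finset.filter_eq_empty_iff] at hne
      have : v = 0 := by ext i; simpa using hne (Finset.mem_univ i)
      exact hc (by simp [this])
    obtain ⟨i, hi, hmin⟩ := Finset.exists_min_image _ id hv0
    have hvi : v i ≠ 0 := (Finset.mem_filter.1 hi).2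
    have hlt : ∀ j < i, v j = 0 := by
      intro j hj
      by_contra hne
      exact absurd (hmin j (by simp [hne])) (not_le.2 hj)
    have hiI : i ∈ I := by
      by_contra h; exact hvi (hv i h)
    refine (Finset.inf'_le _ hiI).trans (lower n _ i ?_ ?_)
    · intro j hj
      simp only [Matrix.vecMul, dotProduct]
      refine Finset.sum_eq_zero fun k _ => ?_
      rcases lt_or_ge k i with h | h
      · simp [hlt k h]
      · simp [hT k j (hj.trans_le h)]
    · have : (v ᵥ* T) i = v i := by
        simp only [Matrix.vecMul, dotProduct]
        rw [Finset.sum_eq_single i]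
        · simp [hTd i hiI]
        · intro k _ hk
          rcases lt_or_gt_of_ne hk with h | h
          · simp [hlt k h]
          · simp [hT k i h]
        · simp
      rwa [this]
  -- the extremal index
  have hne : (I.filter fun i => 2 ^ bitWeight n i.val = W).Nonempty := by
    obtain ⟨i, hi, h⟩ := Finset.exists_mem_eq_inf' hI (fun i => 2 ^ bitWeight n i.val)
    exact ⟨i, Finset.mem_filter.2 ⟨hi, h.symm⟩⟩
  obtain ⟨i, hi, hmax⟩ := Finset.exists_max_image _ id hne
  obtain ⟨hiI, hiW⟩ := Finset.mem_filter.1 hi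
  have hup : ∀ j, i ≤ j → j ∈ I := by
    intro j hij
    refine hdec i hiI j (Relation.ReflTransGen.single (Or.inr ?_))
    refine dom_of_le n _ _ i.isLt j.isLt hij ?_
    intro l hl h1
    by_contra h0
    obtain ⟨k, hk, hik, hsw, hwk⟩ := swap_exists n i.val l i.isLt hl h1 (by simpa using h0)
    have hkI : (⟨k, hk⟩ : Fin (2 ^ n)) ∈ I :=
      hdec i hiI ⟨k, hk⟩ (Relation.ReflTransGen.single (Or.inl hsw))
    have hle := hmax ⟨k, hk⟩ (Finset.mem_filter.2 ⟨hkI, by simpa [hwk] using hiW⟩)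
    have : k ≤ i.val := hle
    omega
  obtain ⟨v, hv, hvT⟩ := single_mem I T hT hTd _ i le_rfl hup
  have hmem : (Pi.single i 1 : Fin (2 ^ n) → ZMod 2) ᵥ* polarG n ∈ ptpc n I T :=
    ⟨v, hv, by rw [← hvT]; rfl⟩
  have hl := lower n (Pi.single i 1) i (fun j hj => by simp [hj.ne]) (by simp)
  have hnz : (Pi.single i 1 : Fin (2 ^ n) → ZMod 2) ᵥ* polarG n ≠ 0 := by
    rw [← hammingNorm_pos_iff]
    exact lt_of_lt_of_le (by positivity) hl
  have heq : hammingNorm ((Pi.single i 1 : Fin (2 ^ n) → ZMod 2) ᵥ* polarG n) = W :=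
    (le_antisymm (upper n i) hl).trans hiW
  refine le_antisymm (Nat.sInf_le ⟨_, hmem, hnz, heq⟩) ?_
  refine le_csInf ⟨W, _, hmem, hnz, heq⟩ ?_
  rintro w ⟨c, hc, hc0, rfl⟩
  exact hlow c hc hc0

/-- For a nonempty decreasing set `I` and any upper triangular `T` with
unit diagonal on `I`, the minimum distance of the PTPC `P(I,T)` equals that of the plain
polar code `P(I)`, and both equal `w_min(I) = min_{i∈I} 2^{w(i)}`. -/
theorem stmt0 (n : ℕ) (I : Finset (Fin (2 ^ n))) (hI : I.Nonempty)
    (hdec : ∀ i ∈ I, ∀ j : Fin (2 ^ n), polarLE i.val j.val → j ∈ I)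
    (T : Matrix (Fin (2 ^ n)) (Fin (2 ^ n)) (ZMod 2))
    (hT : UpperTri T) (hTd : ∀ i ∈ I, T i i = 1) :
    dmin (ptpc n I T) = I.inf' hI (fun i => 2 ^ bitWeight n i.val) ∧
    dmin (polarCode n I) = I.inf' hI (fun i => 2 ^ bitWeight n i.val) := by
  refine ⟨ptpc_main n I hI hdec T hT hTd, ?_⟩
  have h : polarCode n I = ptpc n I 1 := by
    simp [polarCode, ptpc]
  rw [h]
  exact ptpc_main n I hI hdec 1 (fun i j hj => Matrix.one_apply_ne hj.ne')
    (fun i _ => Matrix.one_apply_eq i)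
end

section
/- For every i ∈ {0,...,N-1}, the Hamming weight of the i-th row of G_N is w(g_i) = 2^{w(i)}, where w(i) is the binary Hamming weight of i. -/
open Matrix

/-- The Hamming weight of the `i`-th row of `G_N` is `2^{w(i)}`. -/
theorem stmt2 (n : ℕ) (i : Fin (2 ^ n)) :
    hammingNorm (polarG n i) = 2 ^ bitWeight n i.val := by
  induction n with
  | zero =>
    revert i
    simp only [polarG, bitWeight, hammingNorm]
    decide
  | succ n ih =>
    let e : Fin 2 × Fin (2 ^ n) ≃ Fin (2 ^ (n + 1)) :=
      finProdFinEquiv.trans (finCongr (by ring))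
    obtain ⟨⟨a, b⟩, rfl⟩ := e.surjective i
    have hval : (e (a, b)).val = 2 ^ n * a.val + b.val := by
      simp [e, finProdFinEquiv, add_comm]
    have hrow : ∀ c d, polarG (n + 1) (e (a, b)) (e (c, d)) =
        (!![1, 0; 1, 1] : Matrix (Fin 2) (Fin 2) (ZMod 2)) a c * polarG n b d := by
      intro c d
      change (!![1, 0; 1, 1] : Matrix (Fin 2) (Fin 2) (ZMod 2)) (e.symm (e (a, b))).1
        (e.symm (e (c, d))).1 * polarG n (e.symm (e (a, b))).2 (e.symm (e (c, d))).2 = _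
      simp only [Equiv.symm_apply_apply]
    have hnorm : ∀ {m : ℕ} (x : Fin m → ZMod 2),
        hammingNorm x = ∑ k, if x k ≠ 0 then 1 else 0 := by
      intro m x
      rw [hammingNorm, Finset.card_filter]
    have hb : bitWeight (n + 1) (2 ^ n * a.val + b.val) = bitWeight n b.val + a.val := by
      unfold bitWeight
      rw [Finset.card_filter, Finset.sum_range_succ, Finset.card_filter]
      congr 1
      · apply Finset.sum_congr rfl
        intro l hl
        rw [Nat.testBit_two_pow_mul_add _ b.isLt, if_pos (Finset.mem_range.mp hl)]
      · rw [Nat.testBit_two_pow_mul_add _ b.isLt, if_neg (lt_irrefl n)]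
        fin_cases a <;> simp
    rw [hval, hb, hnorm, ← e.sum_comp, Fintype.sum_prod_type, Fin.sum_univ_two]
    simp only [hrow]
    rw [pow_add, ← ih b, hnorm]
    fin_cases a
    · simp
    · simp [mul_two]
end

section
/- Let I ⊆ {0,...,N-1} be nonempty, let T be upper triangular over F₂ with t_{i,i} = 1 for all i ∈ I, let w_min = min_{i∈I} 2^{w(i)}, and let I_{w_min} = {i ∈ I : 2^{w(i)} = w_min}. If v ∈ F₂^N is nonzero with v_j = 0 for all j ∉ I and the codeword c = v·T·G_N satisfies w(c) < 2·w_min, then the smallest element of the support of u = v·T belongs to I_{w_min}; in particular supp(u) ∩ I_{w_min} ≠ ∅. -/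
open Matrix

theorem polar_hamming_reindex (n : ℕ) (e : Fin 2 × Fin (2 ^ n) ≃ Fin (2 ^ (n + 1)))
    (c : Fin (2 ^ (n + 1)) → ZMod 2) :
    hammingNorm c = hammingNorm (fun y => c (e (0, y))) + hammingNorm (fun y => c (e (1, y))) := by
  simp only [hammingNorm, Finset.card_filter]
  rw [← e.sum_comp, Fintype.sum_prod_type, Fin.sum_univ_two]

theorem polar_bitWeight_lo (n x : ℕ) (hx : x < 2 ^ n) : bitWeight (n + 1) x = bitWeight n x := by
  unfold bitWeight
  rw [Finset.range_add_one, Finset.filter_insert, if_neg]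
  simp [Nat.testBit_lt_two_pow hx]

theorem polar_bitWeight_hi (n x : ℕ) (hx : x < 2 ^ n) :
    bitWeight (n + 1) (x + 2 ^ n) = bitWeight n x + 1 := by
  unfold bitWeight
  rw [Finset.range_add_one, Finset.filter_insert, if_pos, Finset.card_insert_of_notMem]
  · congr 2
    apply Finset.filter_congr
    intro l hl
    rw [Finset.mem_range] at hl
    rw [add_comm, Nat.testBit_two_pow_add_gt hl]
  · simp
  · rw [add_comm, Nat.testBit_two_pow_add_eq, Nat.testBit_lt_two_pow hx]; rfl

theorem polar_row (n : ℕ) : ∀ (u : Fin (2 ^ n) → ZMod 2) (i : Fin (2 ^ n)), u i ≠ 0 →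
    (∀ j < i, u j = 0) → 2 ^ bitWeight n i.val ≤ hammingNorm (u ᵥ* polarG n) := by
  induction n with
  | zero =>
    intro u i hi _
    simp only [polarG, vecMul_one, bitWeight, Finset.range_zero, Finset.filter_empty,
      Finset.card_empty, pow_zero]
    exact hammingNorm_pos_iff.2 (fun h => hi (by rw [h]; rfl))
  | succ n ih =>
    intro u i hi hlt
    obtain ⟨e, he, hv⟩ : ∃ e : Fin 2 × Fin (2 ^ n) ≃ Fin (2 ^ (n + 1)),
        polarG (n + 1) = Matrix.reindex e e (Matrix.kroneckerMap (· * ·)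
          (!![1, 0; 1, 1] : Matrix (Fin 2) (Fin 2) (ZMod 2)) (polarG n)) ∧
        ∀ b x, (e (b, x)).val = x.val + 2 ^ n * b.val :=
      ⟨_, rfl, fun b x => rfl⟩
    have key : ∀ b y, (u ᵥ* polarG (n + 1)) (e (b, y)) =
        ∑ a : Fin 2, (!![1, 0; 1, 1] : Matrix (Fin 2) (Fin 2) (ZMod 2)) a b *
          ((fun x => u (e (a, x))) ᵥ* polarG n) y := by
      intro b y
      rw [he]
      simp only [vecMul, dotProduct]
      rw [← e.sum_comp, Fintype.sum_prod_type]
      refine Finset.sum_congr rfl fun a _ => ?_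
      rw [Finset.mul_sum]
      refine Finset.sum_congr rfl fun x _ => ?_
      simp only [reindex_apply, submatrix_apply, Equiv.symm_apply_apply, kroneckerMap_apply]
      ring
    rw [polar_hamming_reindex n e]
    have k0 : (fun y => (u ᵥ* polarG (n + 1)) (e (0, y))) =
        ((fun x => u (e (0, x))) ᵥ* polarG n) + ((fun x => u (e (1, x))) ᵥ* polarG n) := by
      funext y
      rw [key, Fin.sum_univ_two]
      simp
    have k1 : (fun y => (u ᵥ* polarG (n + 1)) (e (1, y))) =
        ((fun x => u (e (1, x))) ᵥ* polarG n) := by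
      funext y
      rw [key, Fin.sum_univ_two]
      simp
    rw [k0, k1]
    obtain ⟨⟨b, x⟩, rfl⟩ := e.surjective i
    rw [hv]
    have hb : b = 0 ∨ b = 1 := by omega
    rcases hb with rfl | rfl
    · have h1 := ih (fun x => u (e (0, x))) x hi (fun j hj => hlt _ (by
        rw [Fin.lt_def, hv, hv]; simpa using hj))
      simp only [Fin.val_zero, mul_zero, add_zero]
      rw [polar_bitWeight_lo n x x.2]
      refine h1.trans ?_
      generalize ((fun x => u (e (0, x))) ᵥ* polarG n) = p
      generalize ((fun x => u (e (1, x))) ᵥ* polarG n) = q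
      simp only [hammingNorm]
      refine le_trans (Finset.card_le_card ?_) (Finset.card_union_le _ _)
      intro y hy
      simp only [Finset.mem_filter, Finset.mem_union, Finset.mem_univ, true_and,
        Pi.add_apply] at hy ⊢
      by_contra! h
      rw [h.2, add_zero] at h
      exact hy h.1
    · have h1 := ih (fun x => u (e (1, x))) x hi (fun j hj => hlt _ (by
        rw [Fin.lt_def, hv, hv]; simpa using hj))
      have hz : (fun x => u (e (0, x))) = 0 := by
        funext y
        apply hlt
        rw [Fin.lt_def, hv, hv]
        have := y.2
        simp
        omega
      simp only [Fin.val_one, mul_one]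
      rw [polar_bitWeight_hi n x x.2, hz, zero_vecMul, zero_add, pow_succ]
      omega

/-- If the codeword `c = v·T·G_N` of a PTPC has weight less than
`2·w_min`, then the smallest support index of `u = v·T` belongs to
`I_{w_min} = {i ∈ I : 2^{w(i)} = w_min}`; in particular `supp(u) ∩ I_{w_min} ≠ ∅`. -/
theorem stmt6 (n : ℕ) (I : Finset (Fin (2 ^ n))) (hI : I.Nonempty)
    (T : Matrix (Fin (2 ^ n)) (Fin (2 ^ n)) (ZMod 2))
    (hT : UpperTri T) (hTd : ∀ i ∈ I, T i i = 1)
    (v : Fin (2 ^ n) → ZMod 2) (hv : v ≠ 0) (hvI : ∀ j, j ∉ I → v j = 0)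
    (hc : hammingNorm ((v ᵥ* T) ᵥ* polarG n) <
      2 * I.inf' hI (fun i => 2 ^ bitWeight n i.val)) :
    ∃ i₀ : Fin (2 ^ n), IsLeast {j | (v ᵥ* T) j ≠ 0} i₀ ∧ i₀ ∈ I ∧
      2 ^ bitWeight n i₀.val = I.inf' hI (fun i => 2 ^ bitWeight n i.val) := by
  have hex : (Finset.univ.filter fun j => v j ≠ 0).Nonempty := by
    obtain ⟨j, hj⟩ := Function.ne_iff.1 hv
    exact ⟨j, by simpa using hj⟩
  obtain ⟨i, him, hmin⟩ : ∃ i, v i ≠ 0 ∧ ∀ j < i, v j = 0 := by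
    refine ⟨Finset.min' _ hex, (Finset.mem_filter.1 (Finset.min'_mem _ hex)).2, ?_⟩
    intro j hj
    by_contra h
    exact absurd (Finset.min'_le _ j (by simpa using h)) (not_le.2 hj)
  have hiI : i ∈ I := by
    by_contra h
    exact him (hvI i h)
  have hui : (v ᵥ* T) i = v i := by
    simp only [vecMul, dotProduct]
    rw [Finset.sum_eq_single i, hTd i hiI, mul_one]
    · intro j _ hji
      rcases lt_or_gt_of_ne hji with h | h
      · rw [hmin j h, zero_mul]
      · rw [hT j i h, mul_zero]
    · simp
  have huj : ∀ j < i, (v ᵥ* T) j = 0 := by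
    intro j hj
    simp only [vecMul, dotProduct]
    refine Finset.sum_eq_zero fun k _ => ?_
    rcases lt_or_ge k i with h | h
    · rw [hmin k h, zero_mul]
    · rw [hT k j (lt_of_lt_of_le hj h), mul_zero]
  have hui' : (v ᵥ* T) i ≠ 0 := by rw [hui]; exact him
  refine ⟨i, ⟨hui', fun j hj => ?_⟩, hiI, ?_⟩
  · by_contra h
    exact hj (huj j (not_le.1 h))
  · have hrow := polar_row n _ i hui' huj
    have hle := Finset.inf'_le (fun i : Fin (2 ^ n) => 2 ^ bitWeight n i.val) hiI
    obtain ⟨k, _, hk⟩ := Finset.exists_mem_eq_inf' hI (fun i : Fin (2 ^ n) => 2 ^ bitWeight n i.val)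
    rw [hk] at hc hle ⊢
    have h1 := lt_of_le_of_lt hrow hc
    rw [← pow_succ', Nat.pow_lt_pow_iff_right (by norm_num)] at h1
    have h2 := (Nat.pow_le_pow_iff_right (by norm_num)).1 hle
    congr 1
    omega
end

section
/- Fix m with 0 ≤ m ≤ n and set i° = 2^n − 2^{n−m}. Then w(i°) = m, and every i ∈ {0,...,2^n−1} with w(i) = m satisfies i ≼ i° in the polar partial order. Consequently, if I ⊆ {0,...,2^n−1} is decreasing and contains some i with w(i) = m, then i° ∈ I. -/
open Matrix

theorem testBit_top (n m : ℕ) (hm : m ≤ n) (l : ℕ) :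
    (2 ^ n - 2 ^ (n - m)).testBit l = decide (n - m ≤ l ∧ l < n) := by
  have h : 2 ^ n - 2 ^ (n - m) = 2 ^ (n - m) * (2 ^ m - 1) := by
    rw [Nat.mul_sub, ← pow_add, Nat.sub_add_cancel hm, mul_one]
  rw [h, Nat.testBit_two_pow_mul, Nat.testBit_two_pow_sub_one]
  by_cases h1 : n - m ≤ l
  · simp [h1]; omega
  · simp [h1]

theorem bitWeight_top (n m : ℕ) (hm : m ≤ n) : bitWeight n (2 ^ n - 2 ^ (n - m)) = m := by
  have h : (Finset.range n).filter (fun l => (2 ^ n - 2 ^ (n - m)).testBit l)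
      = Finset.Ico (n - m) n := by
    ext l
    simp [testBit_top n m hm]
  rw [bitWeight, h, Nat.card_Ico]
  omega

theorem eq_top_of_sorted (n i : ℕ) (hi : i < 2 ^ n) (m : ℕ) (hm : m ≤ n)
    (hw : bitWeight n i = m)
    (hs : ∀ l, l + 1 < n → i.testBit l = true → i.testBit (l + 1) = true) :
    i = 2 ^ n - 2 ^ (n - m) := by
  have mono : ∀ l l', l ≤ l' → l' < n → i.testBit l = true → i.testBit l' = true := by
    intro l l' hl
    induction l', hl using Nat.le_induction with
    | base => intro _ h; exact h
    | succ k hk ih => intro hkn h; exact hs k hkn (ih (by omega) h)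
  apply Nat.eq_of_testBit_eq
  intro l
  rw [testBit_top n m hm]
  by_cases hln : l < n
  · cases hb : i.testBit l with
    | true =>
      have hsub : Finset.Ico l n ⊆ (Finset.range n).filter (fun l => i.testBit l) := by
        intro k hk
        rw [Finset.mem_Ico] at hk
        simp only [Finset.mem_filter, Finset.mem_range]
        exact ⟨hk.2, mono l k hk.1 hk.2 hb⟩
      have := Finset.card_le_card hsub
      rw [Nat.card_Ico] at this
      unfold bitWeight at hw
      symm
      rw [decide_eq_true_iff]
      omega
    | false =>
      have hsub : (Finset.range n).filter (fun l => i.testBit l) ⊆ Finset.Ico (l + 1) n := by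
        intro k hk
        simp only [Finset.mem_filter, Finset.mem_range] at hk
        rw [Finset.mem_Ico]
        refine ⟨?_, hk.1⟩
        by_contra hc
        have := mono k l (by omega) hln hk.2
        simp [hb] at this
      have := Finset.card_le_card hsub
      rw [Nat.card_Ico] at this
      unfold bitWeight at hw
      symm
      rw [decide_eq_false_iff_not]
      omega
  · rw [Nat.testBit_lt_two_pow (lt_of_lt_of_le hi (Nat.pow_le_pow_right (by norm_num) (by omega)))]
    symm
    rw [decide_eq_false_iff_not]
    omega

theorem swap_step (n i l : ℕ) (hi : i < 2 ^ n) (hl : l + 1 < n)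
    (h1 : i.testBit l = true) (h0 : i.testBit (l + 1) = false) :
    ∃ j, i < j ∧ j < 2 ^ n ∧ leftSwap i j ∧ bitWeight n j = bitWeight n i := by
  obtain ⟨j, hj⟩ : ∃ j, j = (i ^^^ 2 ^ l) ^^^ 2 ^ (l + 1) := ⟨_, rfl⟩
  have hb : ∀ k, j.testBit k = ((i.testBit k ^^ decide (l = k)) ^^ decide (l + 1 = k)) := by
    intro k
    rw [hj, Nat.testBit_xor, Nat.testBit_xor, Nat.testBit_two_pow, Nat.testBit_two_pow]
  have jl : j.testBit l = false := by simp [hb, h1]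
  have jl1 : j.testBit (l + 1) = true := by simp [hb, h0]
  have jo : ∀ k, k ≠ l → k ≠ l + 1 → i.testBit k = j.testBit k := by
    intro k hk hk'
    simp [hb, hk.symm, hk'.symm]
  refine ⟨j, ?_, ?_, ⟨l, h1, h0, jl, jl1, jo⟩, ?_⟩
  · exact Nat.lt_of_testBit (l + 1) h0 jl1 (fun k hk => jo k (by omega) (by omega))
  · rw [hj]
    exact Nat.xor_lt_two_pow (Nat.xor_lt_two_pow hi
      (Nat.pow_lt_pow_right (by norm_num) (by omega))) (Nat.pow_lt_pow_right (by norm_num) hl)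
  · have hset : (Finset.range n).filter (fun k => j.testBit k) =
        insert (l + 1) (((Finset.range n).filter (fun k => i.testBit k)).erase l) := by
      ext k
      simp only [Finset.mem_filter, Finset.mem_range, Finset.mem_insert, Finset.mem_erase]
      by_cases hk : k = l
      · subst hk; simp [jl]
      · by_cases hk' : k = l + 1
        · subst hk'; simp [jl1, hl]
        · simp [hk, hk', jo k hk hk']
    have hmem : l ∈ (Finset.range n).filter (fun k => i.testBit k) := by
      simp [h1]; omega
    unfold bitWeight
    rw [hset, Finset.card_insert_of_notMem (by simp [h0]), Finset.card_erase_add_one hmem]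

theorem polarLE_top (n m : ℕ) (hm : m ≤ n) (d : ℕ) :
    ∀ i < 2 ^ n, 2 ^ n - i ≤ d → bitWeight n i = m → polarLE i (2 ^ n - 2 ^ (n - m)) := by
  induction d with
  | zero => intro i hi hd; omega
  | succ d ih =>
    intro i hi hd hw
    by_cases hs : ∀ l, l + 1 < n → i.testBit l = true → i.testBit (l + 1) = true
    · rw [← eq_top_of_sorted n i hi m hm hw hs]
      exact Relation.ReflTransGen.refl
    · push Not at hs
      obtain ⟨l, hl, h1, h0⟩ := hs
      obtain ⟨j, hij, hj, hsw, hwj⟩ := swap_step n i l hi hl h1 (by simpa using h0)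
      exact Relation.ReflTransGen.head (Or.inl hsw) (ih j hj (by omega) (hwj.trans hw))

/-- For `m ≤ n` and `i° = 2^n − 2^{n−m}`: `w(i°) = m`, every `i < 2^n`
with `w(i) = m` satisfies `i ≼ i°`, and every decreasing `I ⊆ {0,...,2^n−1}` containing
some `i` with `w(i) = m` contains `i°`. -/
theorem stmt7 (n m : ℕ) (hm : m ≤ n) :
    bitWeight n (2 ^ n - 2 ^ (n - m)) = m ∧
    (∀ i < 2 ^ n, bitWeight n i = m → polarLE i (2 ^ n - 2 ^ (n - m))) ∧
    (∀ I : Set ℕ, (∀ i ∈ I, i < 2 ^ n) →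
      (∀ i ∈ I, ∀ j < 2 ^ n, polarLE i j → j ∈ I) →
      (∃ i ∈ I, bitWeight n i = m) → 2 ^ n - 2 ^ (n - m) ∈ I) := by
  have key := fun i hi => polarLE_top n m hm _ i hi le_rfl
  refine ⟨bitWeight_top n m hm, key, ?_⟩
  rintro I hI hdec ⟨i, hiI, hw⟩
  exact hdec i hiI _ (Nat.sub_lt (by positivity) (by positivity)) (key i (hI i hiI) hw)
end

section
/- Fix m with 0 ≤ m ≤ n and set i° = 2^n − 2^{n−m}. Then {j ∈ {0,...,2^n−1} : i° ≼ j} = {j : i° ≤ j ≤ 2^n−1}; that is, j dominates i° in the polar partial order if and only if j ≥ i° as integers, which holds if and only if the m most significant bits of j are all equal to 1. -/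
open Matrix

theorem binDom_le {i j : ℕ} (h : binDom i j) : i ≤ j := by
  have : i &&& j = i := by
    apply Nat.eq_of_testBit_eq
    intro l
    rw [Nat.testBit_and]
    have := h l
    cases hi : i.testBit l <;> simp_all
  rw [← this]
  exact Nat.and_le_right

theorem leftSwap_le {i j : ℕ} (h : leftSwap i j) : i ≤ j := by
  obtain ⟨l, _, h2, _, h4, h5⟩ := h
  exact (Nat.lt_of_testBit (l + 1) h2 h4
    (fun k hk => h5 k (by omega) (by omega))).le

theorem polarLE_le {i j : ℕ} (h : polarLE i j) : i ≤ j := by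
  unfold polarLE at h
  induction h with
  | refl => exact le_rfl
  | tail _ h ih => exact ih.trans (h.elim leftSwap_le binDom_le)

theorem icirc_eq (n m : ℕ) (hm : m ≤ n) :
    2 ^ n - 2 ^ (n - m) = 2 ^ (n - m) * (2 ^ m - 1) := by
  rw [Nat.mul_sub, ← pow_add, Nat.sub_add_cancel hm, mul_one]

theorem bits_of_le (n m : ℕ) (hm : m ≤ n) (j : ℕ) (hj : j < 2 ^ n)
    (h : 2 ^ n - 2 ^ (n - m) ≤ j) :
    ∀ l, n - m ≤ l → l < n → j.testBit l = true := by
  intro l h1 h2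
  rw [icirc_eq n m hm] at h
  have hq : j / 2 ^ (n - m) = 2 ^ m - 1 := by
    have a : 2 ^ m - 1 ≤ j / 2 ^ (n - m) := by
      rw [Nat.le_div_iff_mul_le (by positivity), mul_comm]
      exact h
    have b : j / 2 ^ (n - m) < 2 ^ m := by
      rw [Nat.div_lt_iff_lt_mul (by positivity), ← pow_add, Nat.add_sub_cancel' hm]
      exact hj
    omega
  have e : (j / 2 ^ (n - m)).testBit (l - (n - m)) = j.testBit l := by
    rw [Nat.testBit_div_two_pow]
    congr 1
    omega
  rw [← e, hq, Nat.testBit_two_pow_sub_one]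
  simp
  omega

theorem polarLE_of_bits (n m : ℕ) (hm : m ≤ n) (j : ℕ)
    (h : ∀ l, n - m ≤ l → l < n → j.testBit l = true) :
    polarLE (2 ^ n - 2 ^ (n - m)) j := by
  apply Relation.ReflTransGen.single
  right
  intro l hl
  rw [icirc_eq n m hm, Nat.testBit_two_pow_mul, Nat.testBit_two_pow_sub_one] at hl
  simp at hl
  exact h l (by omega) (by omega)

/-- For `m ≤ n` and `i° = 2^n − 2^{n−m}`, the upward closure of `i°` in
the polar order within `{0,...,2^n−1}` is exactly the integer interval `[i°, 2^n−1]`;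
moreover `i° ≼ j` iff `j ≥ i°` iff the `m` most significant bits of `j` are all 1. -/
theorem stmt8 (n m : ℕ) (hm : m ≤ n) :
    ({j : ℕ | j < 2 ^ n ∧ polarLE (2 ^ n - 2 ^ (n - m)) j} =
      {j : ℕ | 2 ^ n - 2 ^ (n - m) ≤ j ∧ j ≤ 2 ^ n - 1}) ∧
    (∀ j < 2 ^ n,
      (polarLE (2 ^ n - 2 ^ (n - m)) j ↔ 2 ^ n - 2 ^ (n - m) ≤ j) ∧
      (polarLE (2 ^ n - 2 ^ (n - m)) j ↔
        ∀ l, n - m ≤ l → l < n → j.testBit l = true)) := by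
  have key : ∀ j < 2 ^ n, 2 ^ n - 2 ^ (n - m) ≤ j → polarLE (2 ^ n - 2 ^ (n - m)) j :=
    fun j hj h => polarLE_of_bits n m hm j (bits_of_le n m hm j hj h)
  have hp : 0 < 2 ^ n := by positivity
  refine ⟨?_, fun j hj => ⟨⟨polarLE_le, key j hj⟩,
    fun h => bits_of_le n m hm j hj (polarLE_le h), polarLE_of_bits n m hm j⟩⟩
  ext j
  simp only [Set.mem_setOf_eq]
  constructor
  · rintro ⟨h1, h2⟩
    exact ⟨polarLE_le h2, by omega⟩
  · rintro ⟨h1, h2⟩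
    have hj : j < 2 ^ n := by omega
    exact ⟨hj, key j hj h1⟩
end
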